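/- For every integer k ≥ 0, real δ > -1 and every fixed index vector with 1 ≤ i_k < ⋯ < i_0, it holds almost surely that N_n(i_0,…,i_k)/n − E[N_n(i_0,…,i_k)]/n → 0 as n → ∞. -/

import Mathlib

open MeasureTheory Filter Finset

noncomputable section

/-- The coefficient `b_m = k - m + 1 + δ(k - m)`. -/
def bcoef (k : ℕ) (δ : ℝ) (m : ℕ) : ℝ := (k : ℝ) - m + 1 + δ * ((k : ℝ) - m)

/-- The coefficient `τ = k + 2 + δ(k + 1)`. -/
def tauc (k : ℕ) (δ : ℝ) : ℝ := (k : ℝ) + 2 + δ * ((k : ℝ) + 1)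

/-- A vector `(i_0, …, i_k)` of degrees is valid when `1 ≤ i_k < i_{k-1} < ⋯ < i_0`. -/
def ValidIdx (k : ℕ) (i : Fin (k + 1) → ℕ) : Prop :=
  1 ≤ i (Fin.last k) ∧ StrictAnti i

/-- Decrease every coordinate of the index vector by one. -/
def allDec (k : ℕ) (i : Fin (k + 1) → ℕ) : Fin (k + 1) → ℕ := fun ℓ => i ℓ - 1

/-- Decrease the coordinates `0, …, m` of the index vector by one. -/
def decUpTo (k : ℕ) (m : ℕ) (i : Fin (k + 1) → ℕ) : Fin (k + 1) → ℕ :=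
  fun ℓ => if (ℓ : ℕ) ≤ m then i ℓ - 1 else i ℓ

/-- The limiting degree recursion: `p` vanishes outside the valid index vectors, and on the
valid index vectors it satisfies the recursion of Theorem 2.1 of the paper. -/
def LimitRecursion (k : ℕ) (δ : ℝ) (p : (Fin (k + 1) → ℕ) → ℝ) : Prop :=
  (∀ i, ¬ ValidIdx k i → p i = 0) ∧
  ∀ i, ValidIdx k i →
    p i = ((i (Fin.last k) : ℝ) - 1 + δ) / tauc k δ * p (allDec k i)
      + (∑ m : Fin k,
          (((i m.castSucc : ℝ) - 1 - k + (m : ℕ)) * bcoef k δ (m : ℕ)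
            - ((i m.succ : ℝ) - k + (m : ℕ) + 1) * bcoef k δ ((m : ℕ) + 1)) / tauc k δ
            * p (decUpTo k (m : ℕ) i))
      - (((i 0 : ℝ) - k) * bcoef k δ 0 + δ) / tauc k δ * p i
      + (if ∀ ℓ : Fin (k + 1), i ℓ = k - (ℓ : ℕ) + 1 then (1 : ℝ) else 0)

instance : MeasurableSpace (Finset ℕ) := ⊤
instance : MeasurableSpace (Finset (Finset ℕ)) := ⊤

/-- The `m`-degree of an `m`-simplex `s` in the simplicial complex `g`: the number of
`(m+1)`-simplices (i.e. sets of cardinality `m+2`) of `g` containing `s`. -/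
def simDeg (m : ℕ) (g : Finset (Finset ℕ)) (s : Finset ℕ) : ℕ :=
  (g.filter fun t => s ⊆ t ∧ t.card = m + 2).card

/-- The initial complex: one `(k+1)`-simplex on the vertex set `{1, …, k+2}` together
with all its (nonempty) subsimplices. -/
def initComplex (k : ℕ) : Finset (Finset ℕ) :=
  (Finset.Icc 1 (k + 2)).powerset.filter fun s => s.Nonempty

/-- Add to `g` the simplex `s ∪ {v}` together with all of its (nonempty) subsimplices. -/
def addSimplex (g : Finset (Finset ℕ)) (s : Finset ℕ) (v : ℕ) : Finset (Finset ℕ) :=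
  g ∪ (insert v s).powerset.filter fun t => t.Nonempty

/-- The set of `k`-simplices (sets of cardinality `k+1`) of the complex `g`. -/
def kSimplices (k : ℕ) (g : Finset (Finset ℕ)) : Finset (Finset ℕ) :=
  g.filter fun s => s.card = k + 1

/-- The preferential attachment simplicial complex with parameters `k` and `δ`:
`G n ω` is the complex at time `n`, `choice n ω` is the `k`-simplex selected by the vertex
arriving at time `n ≥ 1`, chosen among the `k`-simplices of `G (n-1)` with conditional
probability proportional to its `k`-degree plus `δ`. -/
structure PAComplex (k : ℕ) (δ : ℝ) (Ω : Type*) [MeasurableSpace Ω] where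
  μ : Measure Ω
  isProb : IsProbabilityMeasure μ
  G : ℕ → Ω → Finset (Finset ℕ)
  choice : ℕ → Ω → Finset ℕ
  meas_G : ∀ n, Measurable (G n)
  meas_choice : ∀ n, Measurable (choice n)
  init : ∀ ω, G 0 ω = initComplex k
  choice_mem : ∀ n ω, 1 ≤ n → choice n ω ∈ kSimplices k (G (n - 1) ω)
  step : ∀ n ω, 1 ≤ n → G n ω = addSimplex (G (n - 1) ω) (choice n ω) (n + k + 2)
  cond_law : ∀ n : ℕ, 1 ≤ n → ∀ g : ℕ → Finset (Finset ℕ),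
    ∀ s ∈ kSimplices k (g (n - 1)),
      μ {ω | choice n ω = s ∧ ∀ j < n, G j ω = g j}
        = ENNReal.ofReal (((simDeg k (g (n - 1)) s : ℝ) + δ) /
            ∑ t ∈ kSimplices k (g (n - 1)), ((simDeg k (g (n - 1)) t : ℝ) + δ)) *
          μ {ω | ∀ j < n, G j ω = g j}

/-- The `c` largest vertices of the simplex `s` (so for an enumeration
`s = {v_0 < v_1 < ⋯ < v_k}` and `c = m+1` this is the youngest `m`-simplex
`{v_{k-m}, …, v_k}`). -/
def topSub (s : Finset ℕ) (c : ℕ) : Finset ℕ :=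
  s.filter fun v => (s.filter fun w => v < w).card < c

/-- `Ncount k g i` is the number of `k`-simplices `s = {v_0 < ⋯ < v_k}` of `g` such that
for each `m = 0, …, k` the `m`-degree of the youngest `m`-simplex `{v_{k-m}, …, v_k}`
equals `i m`. -/
def Ncount (k : ℕ) (g : Finset (Finset ℕ)) (i : Fin (k + 1) → ℕ) : ℕ :=
  ((kSimplices k g).filter fun s =>
    ∀ m : Fin (k + 1), simDeg (m : ℕ) g (topSub s ((m : ℕ) + 1)) = i m).card

/-- The number of members of `g` of cardinality `c + 1` containing `t`. -/
def cofaceCount (c : ℕ) (g : Finset (Finset ℕ)) (t : Finset ℕ) : ℕ :=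
  (g.filter fun u => t ⊆ u ∧ u.card = c + 1).card

/-- The total selection weight of the `k`-simplices of `g` containing `t`. -/
def starWeight (k : ℕ) (δ : ℝ) (g : Finset (Finset ℕ)) (t : Finset ℕ) : ℝ :=
  ∑ s ∈ (kSimplices k g).filter (fun s => t ⊆ s), ((simDeg k g s : ℝ) + δ)

/-- The selection weight of the star of a face with `c` vertices and degree `d`. -/
def affineWeight (k : ℕ) (δ : ℝ) (c : ℕ) (d : ℝ) : ℝ :=
  ((k : ℝ) + 2 - c + δ * ((k : ℝ) + 1 - c)) * (d - ((k : ℝ) + 2 - c))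
    + ((k : ℝ) + 2 - c) * (1 + δ)

/-- The faces of the simplex `insert w s` that contain `w`. -/
def newFaces (s : Finset ℕ) (w : ℕ) : Finset (Finset ℕ) :=
  (insert w s).powerset.filter fun u => w ∈ u

/-- The structural properties of the complex at time `n` which are preserved by the dynamics. -/
structure IsPAState (k : ℕ) (δ : ℝ) (n : ℕ) (g : Finset (Finset ℕ)) : Prop where
  nonempty : ∀ u ∈ g, u.Nonempty
  down : ∀ u ∈ g, ∀ t ⊆ u, t.Nonempty → t ∈ g
  le : ∀ u ∈ g, ∀ x ∈ u, x ≤ n + k + 2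
  weight : ∀ t, t = ∅ ∨ t ∈ g → t.card ≤ k + 1 →
    starWeight k δ g t = affineWeight k δ t.card (cofaceCount t.card g t)
  deg_ge : ∀ t, t = ∅ ∨ t ∈ g → t.card ≤ k + 1 → k + 2 ≤ cofaceCount t.card g t + t.card
  verts : cofaceCount 0 g ∅ = n + k + 2
  top : ∀ t, ((kSimplices k g).filter fun s => topSub s 1 = t).card ≤ k + 2

lemma simDeg_eq_cofaceCount (m : ℕ) (g : Finset (Finset ℕ)) (s : Finset ℕ) :
    simDeg m g s = cofaceCount (m + 1) g s := rfl

lemma mem_kSimplices {k : ℕ} {g : Finset (Finset ℕ)} {s : Finset ℕ} :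
    s ∈ kSimplices k g ↔ s ∈ g ∧ s.card = k + 1 := by
  simp [kSimplices]

lemma mem_newFaces {s : Finset ℕ} {w : ℕ} {u : Finset ℕ} :
    u ∈ newFaces s w ↔ u ⊆ insert w s ∧ w ∈ u := by
  simp [newFaces]

lemma mem_addSimplex {g : Finset (Finset ℕ)} {s : Finset ℕ} {v : ℕ} {u : Finset ℕ} :
    u ∈ addSimplex g s v ↔ u ∈ g ∨ (u ⊆ insert v s ∧ u.Nonempty) := by
  simp [addSimplex]

lemma card_covering_supersets {t S : Finset ℕ} (h : t ⊆ S) :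
    (S.powerset.filter fun u => t ⊆ u ∧ u.card = t.card + 1).card + t.card = S.card := by
  have : (S.powerset.filter fun u => t ⊆ u ∧ u.card = t.card + 1)
      = (S \ t).image (fun y => insert y t) := by
    ext u
    simp only [mem_filter, mem_powerset, mem_image, Finset.mem_sdiff]
    constructor
    · rintro ⟨hu, htu, hc⟩
      have h1 : (u \ t).card = 1 := by
        rw [card_sdiff_of_subset htu]; omega
      obtain ⟨y, hy⟩ := card_eq_one.1 h1
      have hy' : y ∈ u \ t := by rw [hy]; simp
      refine ⟨y, ⟨hu (Finset.mem_sdiff.1 hy').1, (Finset.mem_sdiff.1 hy').2⟩, ?_⟩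
      rw [insert_eq, ← hy, sdiff_union_of_subset htu]
    · rintro ⟨y, ⟨hyS, hyt⟩, rfl⟩
      exact ⟨insert_subset hyS h, subset_insert _ _, card_insert_of_notMem hyt⟩
  rw [this, card_image_of_injOn, card_sdiff_of_subset h]
  · have := card_le_card h; omega
  · intro x hx y hy hxy
    simp only [coe_sdiff, Set.mem_sdiff, mem_coe] at hx hy
    have : x ∈ insert y t := by
      rw [← (show insert x t = insert y t from hxy)]; exact mem_insert_self _ _
    rcases mem_insert.1 this with h | h
    · exact h
    · exact absurd h hx.2

section Step

variable {k : ℕ} {δ : ℝ} {n : ℕ} {g : Finset (Finset ℕ)} {s : Finset ℕ} {w : ℕ}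

lemma IsPAState.addSimplex_eq (h : IsPAState k δ n g) (hs : s ∈ kSimplices k g) (w : ℕ) :
    addSimplex g s w = g ∪ newFaces s w := by
  ext u
  simp only [mem_addSimplex, mem_union, mem_newFaces]
  constructor
  · rintro (hu | ⟨hu, hne⟩)
    · exact Or.inl hu
    · by_cases hw : w ∈ u
      · exact Or.inr ⟨hu, hw⟩
      · exact Or.inl (h.down s (mem_kSimplices.1 hs).1 u ((subset_insert_iff_of_notMem hw).1 hu) hne)
  · rintro (hu | ⟨hu, hw⟩)
    · exact Or.inl hu
    · exact Or.inr ⟨hu, ⟨w, hw⟩⟩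

lemma disjoint_newFaces (hw : ∀ u ∈ g, w ∉ u) : Disjoint g (newFaces s w) := by
  rw [disjoint_left]
  intro u hu hu'
  exact hw u hu (mem_newFaces.1 hu').2

lemma cofaceCount_union (hw : ∀ u ∈ g, w ∉ u) (c : ℕ) (t : Finset ℕ) :
    cofaceCount c (g ∪ newFaces s w) t = cofaceCount c g t + cofaceCount c (newFaces s w) t := by
  unfold cofaceCount
  rw [filter_union, card_union_of_disjoint]
  exact disjoint_filter_filter (disjoint_newFaces hw)

lemma cofaceCount_eq_zero (hw : ∀ u ∈ g, w ∉ u) (c : ℕ) {t : Finset ℕ} (ht : w ∈ t) :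
    cofaceCount c g t = 0 := by
  unfold cofaceCount
  rw [card_eq_zero, filter_eq_empty_iff]
  rintro u hu ⟨h1, -⟩
  exact hw u hu (h1 ht)

lemma cofaceCount_newFaces_of_notMem {t : Finset ℕ} (ht : w ∉ t) :
    cofaceCount t.card (newFaces s w) t = if t ⊆ s then 1 else 0 := by
  unfold cofaceCount
  split_ifs with hts
  · rw [card_eq_one]
    refine ⟨insert w t, ?_⟩
    ext u
    simp only [mem_filter, mem_newFaces, mem_singleton]
    constructor
    · rintro ⟨⟨-, h2⟩, h3, h4⟩
      refine (eq_of_subset_of_card_le (insert_subset h2 h3) ?_).symm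
      rw [h4, card_insert_of_notMem ht]
    · rintro rfl
      exact ⟨⟨insert_subset_insert _ hts, mem_insert_self _ _⟩, subset_insert _ _,
        card_insert_of_notMem ht⟩
  · rw [card_eq_zero, filter_eq_empty_iff]
    rintro u hu ⟨h1, -⟩
    exact hts ((subset_insert_iff_of_notMem ht).1 (h1.trans (mem_newFaces.1 hu).1))

lemma cofaceCount_newFaces_of_mem (hws : w ∉ s) {t : Finset ℕ} (ht : w ∈ t) (hts : t ⊆ insert w s) :
    cofaceCount t.card (newFaces s w) t + t.card = s.card + 1 := by
  rw [← card_insert_of_notMem hws, ← card_covering_supersets hts]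
  unfold cofaceCount newFaces
  rw [filter_filter]
  congr 2
  refine filter_congr fun u _ => ⟨fun h => h.2, fun h => ⟨h.1 ht, h⟩⟩

lemma kSimplices_union (hws : w ∉ s) (hs : s.card = k + 1) :
    kSimplices k (g ∪ newFaces s w)
      = kSimplices k g ∪ s.image (fun x => insert w (s.erase x)) := by
  have : kSimplices k (newFaces s w) = s.image (fun x => insert w (s.erase x)) := by
    ext u
    simp only [mem_kSimplices, mem_newFaces, mem_image]
    constructor
    · rintro ⟨⟨h1, h2⟩, h3⟩
      have h4 : (insert w s \ u).card = 1 := by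
        rw [card_sdiff_of_subset h1, card_insert_of_notMem hws]; omega
      obtain ⟨x, hx⟩ := card_eq_one.1 h4
      have hx' : x ∈ insert w s \ u := by rw [hx]; simp
      have hxw : x ≠ w := fun h => (Finset.mem_sdiff.1 hx').2 (h ▸ h2)
      refine ⟨x, mem_of_mem_insert_of_ne (Finset.mem_sdiff.1 hx').1 hxw, ?_⟩
      rw [← erase_insert_of_ne hxw.symm, ← sdiff_singleton_eq_erase, ← hx, Finset.sdiff_sdiff_eq_self h1]
    · rintro ⟨x, hx, rfl⟩
      refine ⟨⟨insert_subset_insert _ (erase_subset _ _), mem_insert_self _ _⟩, ?_⟩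
      rw [card_insert_of_notMem (fun h => hws (mem_of_mem_erase h)), card_erase_of_mem hx]
      omega
  rw [← this]
  unfold kSimplices
  rw [filter_union]

lemma injOn_insert_erase (hws : w ∉ s) :
    Set.InjOn (fun x => insert w (s.erase x)) (s : Set ℕ) := by
  intro x hx y hy hxy
  by_contra hne
  have : x ∈ insert w (s.erase y) := mem_insert_of_mem (mem_erase.2 ⟨hne, hx⟩)
  rw [← (show insert w (s.erase x) = insert w (s.erase y) from hxy)] at this
  rcases mem_insert.1 this with h | h
  · exact hws (h ▸ hx)
  · simp at h

lemma disjoint_newSimplices (hw : ∀ u ∈ g, w ∉ u) :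
    Disjoint (kSimplices k g) (s.image (fun x => insert w (s.erase x))) := by
  rw [disjoint_left]
  intro u hu hu'
  obtain ⟨x, -, rfl⟩ := mem_image.1 hu'
  exact hw _ (mem_kSimplices.1 hu).1 (mem_insert_self _ _)

/-- Summation over the `k`-simplices of the complex after one step. -/
lemma sum_kSimplices_union (hw : ∀ u ∈ g, w ∉ u) (hs : s ∈ kSimplices k g) (f : Finset ℕ → ℝ) :
    ∑ u ∈ kSimplices k (g ∪ newFaces s w), f u
      = ∑ u ∈ kSimplices k g, f u + ∑ x ∈ s, f (insert w (s.erase x)) := by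
  obtain ⟨h1, h2⟩ := mem_kSimplices.1 hs
  rw [kSimplices_union (hw s h1) h2, sum_union (disjoint_newSimplices hw),
    sum_image (injOn_insert_erase (hw s h1))]

lemma simDeg_union_old (hw : ∀ u ∈ g, w ∉ u) (hs : s ∈ kSimplices k g) {u : Finset ℕ}
    (hu : u ∈ kSimplices k g) :
    simDeg k (g ∪ newFaces s w) u = simDeg k g u + if u = s then 1 else 0 := by
  obtain ⟨h1, h2⟩ := mem_kSimplices.1 hs
  obtain ⟨h3, h4⟩ := mem_kSimplices.1 hu
  rw [simDeg_eq_cofaceCount, simDeg_eq_cofaceCount, ← h4, cofaceCount_union hw,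
    cofaceCount_newFaces_of_notMem (hw u h3)]
  congr 1
  refine if_congr ⟨fun h => eq_of_subset_of_card_le h (by omega), fun h => h ▸ Subset.rfl⟩ rfl rfl

lemma simDeg_union_new (hw : ∀ u ∈ g, w ∉ u) (hs : s ∈ kSimplices k g) {x : ℕ} (hx : x ∈ s) :
    simDeg k (g ∪ newFaces s w) (insert w (s.erase x)) = 1 := by
  obtain ⟨h1, h2⟩ := mem_kSimplices.1 hs
  have hc : (insert w (s.erase x)).card = k + 1 := by
    rw [card_insert_of_notMem (fun h => hw s h1 (mem_of_mem_erase h)), card_erase_of_mem hx]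
    omega
  have := cofaceCount_newFaces_of_mem (hw s h1) (mem_insert_self w (s.erase x))
    (insert_subset_insert _ (erase_subset _ _))
  rw [simDeg_eq_cofaceCount, cofaceCount_union hw, cofaceCount_eq_zero hw _ (mem_insert_self _ _),
    ← hc]
  omega

lemma subset_insert_erase_iff (hws : w ∉ s) {t : Finset ℕ} (hts : t ⊆ insert w s) {x : ℕ}
    (hx : x ∈ s) : t ⊆ insert w (s.erase x) ↔ x ∉ t := by
  have hxw : x ≠ w := fun h => hws (h ▸ hx)
  rw [← erase_insert_of_ne hxw.symm, subset_erase]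
  exact ⟨fun h => h.2, fun h => ⟨hts, h⟩⟩

lemma starWeight_union (hw : ∀ u ∈ g, w ∉ u) (hs : s ∈ kSimplices k g) (t : Finset ℕ) :
    starWeight k δ (g ∪ newFaces s w) t = starWeight k δ g t + (if t ⊆ s then 1 else 0)
      + ((s.filter fun x => t ⊆ insert w (s.erase x)).card : ℝ) * (1 + δ) := by
  unfold starWeight
  rw [sum_filter, sum_kSimplices_union hw hs, sum_filter]
  congr 1
  · have : ∀ u ∈ kSimplices k g, (if t ⊆ u then
        ((simDeg k (g ∪ newFaces s w) u : ℝ) + δ) else 0)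
        = (if t ⊆ u then ((simDeg k g u : ℝ) + δ) else 0)
          + if u = s then (if t ⊆ s then 1 else 0) else 0 := by
      intro u hu
      rw [simDeg_union_old hw hs hu]
      by_cases hus : u = s
      · subst hus
        by_cases htu : t ⊆ u
        · simp [htu]; ring
        · simp [htu]
      · simp [hus]
    rw [sum_congr rfl this, sum_add_distrib, sum_ite_eq' _ _ _, if_pos hs]
  · rw [← sum_filter, ← nsmul_eq_mul, ← sum_const]
    refine sum_congr rfl fun x hx => ?_
    rw [simDeg_union_new hw hs (mem_filter.1 hx).1]
    simp

lemma card_filter_subset_insert_erase (hws : w ∉ s) {t : Finset ℕ} (hts : t ⊆ insert w s) :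
    (s.filter fun x => t ⊆ insert w (s.erase x)).card + (t.erase w).card = s.card := by
  have : (s.filter fun x => t ⊆ insert w (s.erase x)) = s \ t.erase w := by
    ext x
    simp only [mem_filter, Finset.mem_sdiff, mem_erase, not_and]
    refine and_congr_right fun hx => ?_
    rw [subset_insert_erase_iff hws hts hx]
    exact ⟨fun h _ => h, fun h => h (fun e => hws (e ▸ hx))⟩
  have hsub : t.erase w ⊆ s := by
    rw [← subset_insert_iff]; exact hts
  rw [this, card_sdiff_of_subset hsub]
  have := card_le_card hsub
  omega

end Step

section TopSub

lemma topSub_subset (s : Finset ℕ) (c : ℕ) : topSub s c ⊆ s := filter_subset _ _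

lemma topSub_zero (s : Finset ℕ) : topSub s 0 = ∅ := by simp [topSub]

lemma topSub_mono (s : Finset ℕ) {c d : ℕ} (h : c ≤ d) : topSub s c ⊆ topSub s d :=
  monotone_filter_right s fun _ _ hv => lt_of_lt_of_le hv h

lemma card_topSub {s : Finset ℕ} {c : ℕ} (h : c ≤ s.card) : (topSub s c).card = c := by
  have hinj : Set.InjOn (fun v => (s.filter fun w => v < w).card) (s : Set ℕ) := by
    have key : ∀ x ∈ s, ∀ y ∈ s, x < y →
        (s.filter fun w => y < w).card < (s.filter fun w => x < w).card := by
      intro x hx y hy hxy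
      apply card_lt_card
      rw [ssubset_iff_of_subset (monotone_filter_right s fun _ _ hv => hxy.trans hv)]
      exact ⟨y, by simp [hy, hxy], by simp⟩
    intro x hx y hy hxy
    rcases lt_trichotomy x y with h | h | h
    · exact absurd hxy (key x hx y hy h).ne'
    · exact h
    · exact absurd hxy (key y hy x hx h).ne
  have himg : s.image (fun v => (s.filter fun w => v < w).card) = range s.card := by
    apply eq_of_subset_of_card_le
    · intro m hm
      obtain ⟨v, hv, rfl⟩ := mem_image.1 hm
      refine mem_range.2 (card_lt_card ?_)
      rw [ssubset_iff_of_subset (filter_subset _ _)]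
      exact ⟨v, hv, by simp⟩
    · rw [card_range, card_image_of_injOn hinj]
  have h2 : (topSub s c).image (fun v => (s.filter fun w => v < w).card) = range c := by
    have : range c = (range s.card).filter (· < c) := by
      ext m; simp only [mem_range, mem_filter]; omega
    rw [this, ← himg, filter_image]
    rfl
  rw [← card_image_of_injOn (hinj.mono (coe_subset.2 (topSub_subset s c))), h2, card_range]

lemma mem_topSub_of_max {s : Finset ℕ} {w : ℕ} (hw : w ∈ s) (hmax : ∀ x ∈ s, x ≤ w) {c : ℕ}
    (hc : 1 ≤ c) : w ∈ topSub s c := by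
  have : (s.filter fun x => w < x) = ∅ :=
    filter_eq_empty_iff.2 fun x hx => not_lt.2 (hmax x hx)
  simp only [topSub, mem_filter, hw, this, card_empty, true_and]
  omega

end TopSub

section Preservation

variable {k : ℕ} {δ : ℝ} {n : ℕ} {g : Finset (Finset ℕ)} {s : Finset ℕ}

lemma IsPAState.notMem_of_fresh (h : IsPAState k δ n g) : ∀ u ∈ g, n + 1 + k + 2 ∉ u := by
  intro u hu hw
  have := h.le u hu _ hw
  omega

lemma newSimplex_max (h : IsPAState k δ n g) (hs : s ∈ kSimplices k g) {x : ℕ} :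
    ∀ y ∈ insert (n + 1 + k + 2) (s.erase x), y ≤ n + 1 + k + 2 := by
  intro y hy
  rcases mem_insert.1 hy with hy | hy
  · omega
  · have := h.le s (mem_kSimplices.1 hs).1 y (mem_of_mem_erase hy)
    omega

lemma IsPAState.step (h : IsPAState k δ n g) (hs : s ∈ kSimplices k g) :
    IsPAState k δ (n + 1) (addSimplex g s (n + 1 + k + 2)) := by
  rw [h.addSimplex_eq hs]
  have hw := h.notMem_of_fresh
  set w := n + 1 + k + 2 with hwdef
  obtain ⟨hsg, hsc⟩ := mem_kSimplices.1 hs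
  have hws := hw s hsg
  have hface : ∀ t, t = ∅ ∨ t ∈ g ∪ newFaces s w →
      (w ∉ t ∧ (t = ∅ ∨ t ∈ g)) ∨ (w ∈ t ∧ t ⊆ insert w s) := by
    rintro t (rfl | ht)
    · simp
    · rcases mem_union.1 ht with ht | ht
      · exact Or.inl ⟨hw t ht, Or.inr ht⟩
      · exact Or.inr (mem_newFaces.1 ht).symm
  refine ⟨?_, ?_, ?_, ?_, ?_, ?_, ?_⟩
  · intro u hu
    rcases mem_union.1 hu with hu | hu
    · exact h.nonempty u hu
    · exact ⟨w, (mem_newFaces.1 hu).2⟩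
  · intro u hu t htu ht
    rcases mem_union.1 hu with hu | hu
    · exact mem_union_left _ (h.down u hu t htu ht)
    · by_cases hwt : w ∈ t
      · exact mem_union_right _ (mem_newFaces.2 ⟨htu.trans (mem_newFaces.1 hu).1, hwt⟩)
      · exact mem_union_left _ (h.down s hsg t
          ((subset_insert_iff_of_notMem hwt).1 (htu.trans (mem_newFaces.1 hu).1)) ht)
  · intro u hu x hx
    rcases mem_union.1 hu with hu | hu
    · have := h.le u hu x hx; omega
    · rcases mem_insert.1 ((mem_newFaces.1 hu).1 hx) with hx | hx
      · omega
      · have := h.le s hsg x hx; omega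
  · intro t ht htc
    rw [starWeight_union hw hs]
    rcases hface t ht with ⟨hwt, ht⟩ | ⟨hwt, hts⟩
    · rw [h.weight t ht htc, cofaceCount_union hw, cofaceCount_newFaces_of_notMem hwt]
      by_cases hts : t ⊆ s
      · have := card_filter_subset_insert_erase hws (hts.trans (subset_insert w s))
        rw [erase_eq_of_notMem hwt, hsc] at this
        have hr : ((s.filter fun x => t ⊆ insert w (s.erase x)).card : ℝ) = k + 1 - t.card := by
          rw [eq_sub_iff_add_eq]; exact_mod_cast this
        rw [hr]
        simp only [hts, if_true, affineWeight]
        push_cast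
        ring
      · have : (s.filter fun x => t ⊆ insert w (s.erase x)) = ∅ :=
          filter_eq_empty_iff.2 fun x _ hx => hts
            (((subset_insert_iff_of_notMem hwt).1 hx).trans (erase_subset _ _))
        simp [this, hts]
    · have h1 := card_filter_subset_insert_erase hws hts
      rw [card_erase_of_mem hwt, hsc] at h1
      have h2 := cofaceCount_newFaces_of_mem hws hwt hts
      have h3 : 0 < t.card := card_pos.2 ⟨w, hwt⟩
      have h4 : starWeight k δ g t = 0 := by
        refine sum_eq_zero fun u hu => ?_
        rw [mem_filter] at hu
        exact absurd (hu.2 hwt) (hw u (mem_kSimplices.1 hu.1).1)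
      have hts' : ¬ t ⊆ s := fun h => hws (h hwt)
      rw [h4, cofaceCount_union hw, cofaceCount_eq_zero hw _ hwt, if_neg hts']
      have hr : ((s.filter fun x => t ⊆ insert w (s.erase x)).card : ℝ) = k + 2 - t.card := by
        rw [eq_sub_iff_add_eq]
        have : (s.filter fun x => t ⊆ insert w (s.erase x)).card + t.card = k + 2 := by omega
        exact_mod_cast this
      have hr2 : (cofaceCount t.card (newFaces s w) t : ℝ) = k + 2 - t.card := by
        rw [eq_sub_iff_add_eq]
        have : cofaceCount t.card (newFaces s w) t + t.card = k + 2 := by omega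
        exact_mod_cast this
      rw [hr, Nat.zero_add, hr2]
      simp [affineWeight]
  · intro t ht htc
    rw [cofaceCount_union hw]
    rcases hface t ht with ⟨hwt, ht⟩ | ⟨hwt, hts⟩
    · have := h.deg_ge t ht htc
      omega
    · have := cofaceCount_newFaces_of_mem hws hwt hts
      omega
  · rw [cofaceCount_union hw, h.verts]
    have := cofaceCount_newFaces_of_notMem (s := s) (notMem_empty w)
    rw [card_empty, if_pos (empty_subset s)] at this
    omega
  · intro t
    have hmem : ∀ x ∈ s, w ∈ topSub (insert w (s.erase x)) 1 := fun x _ =>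
      mem_topSub_of_max (mem_insert_self _ _) (newSimplex_max h hs) le_rfl
    rw [kSimplices_union hws hsc, filter_union]
    by_cases hwt : w ∈ t
    · have : (kSimplices k g).filter (fun s => topSub s 1 = t) = ∅ := by
        refine filter_eq_empty_iff.2 fun u hu hut => ?_
        exact hw u (mem_kSimplices.1 hu).1 (topSub_subset u 1 (hut ▸ hwt))
      rw [this, empty_union]
      refine (card_filter_le _ _).trans (card_image_le.trans ?_)
      omega
    · have : (s.image fun x => insert w (s.erase x)).filter (fun s => topSub s 1 = t) = ∅ := by
        refine filter_eq_empty_iff.2 fun u hu hut => ?_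
        obtain ⟨x, hx, rfl⟩ := mem_image.1 hu
        exact hwt (hut ▸ hmem x hx)
      rw [this, union_empty]
      exact h.top t

lemma isPAState_initComplex (k : ℕ) (δ : ℝ) : IsPAState k δ 0 (initComplex k) := by
  set S := Finset.Icc 1 (k + 2) with hS
  have hSc : S.card = k + 2 := by simp [hS]
  have hmem : ∀ u, u ∈ initComplex k ↔ u ⊆ S ∧ u.Nonempty := by
    intro u; simp [initComplex, hS]
  have hdeg : ∀ t ⊆ S, cofaceCount t.card (initComplex k) t + t.card = k + 2 := by
    intro t ht
    rw [← hSc, ← card_covering_supersets ht]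
    unfold cofaceCount initComplex
    rw [filter_filter]
    congr 2
    refine filter_congr fun u _ => ⟨fun h => h.2, fun h => ⟨card_pos.1 (by omega), h⟩⟩
  have hface : ∀ t, t = ∅ ∨ t ∈ initComplex k → t ⊆ S := by
    rintro t (rfl | ht)
    · exact empty_subset _
    · exact ((hmem t).1 ht).1
  have hks : kSimplices k (initComplex k) = S.powersetCard (k + 1) := by
    ext u
    rw [mem_kSimplices, hmem, mem_powersetCard]
    exact ⟨fun h => ⟨h.1.1, h.2⟩, fun h => ⟨⟨h.1, card_pos.1 (by omega)⟩, h.2⟩⟩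
  refine ⟨fun u hu => ((hmem u).1 hu).2,
    fun u hu t htu ht => (hmem t).2 ⟨htu.trans ((hmem u).1 hu).1, ht⟩, ?_, ?_, ?_, ?_, ?_⟩
  · intro u hu x hx
    have := ((hmem u).1 hu).1 hx
    rw [hS, Finset.mem_Icc] at this
    omega
  · intro t ht htc
    have htS := hface t ht
    have hw : ∀ u ∈ (kSimplices k (initComplex k)).filter (fun s => t ⊆ s),
        ((simDeg k (initComplex k) u : ℝ) + δ) = 1 + δ := by
      intro u hu
      rw [hks, mem_filter, mem_powersetCard] at hu
      have := hdeg u hu.1.1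
      rw [simDeg_eq_cofaceCount, ← hu.1.2]
      have h1 : cofaceCount u.card (initComplex k) u = 1 := by omega
      rw [h1, Nat.cast_one]
    have hcount : ((kSimplices k (initComplex k)).filter (fun s => t ⊆ s)).card + t.card
        = k + 2 := by
      have : (kSimplices k (initComplex k)).filter (fun s => t ⊆ s)
          = (S \ t).image (fun x => S.erase x) := by
        ext u
        rw [hks, mem_filter, mem_powersetCard, mem_image]
        constructor
        · rintro ⟨⟨h1, h2⟩, h3⟩
          have h4 : (S \ u).card = 1 := by rw [card_sdiff_of_subset h1]; omega
          obtain ⟨x, hx⟩ := card_eq_one.1 h4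
          have hx' : x ∈ S \ u := by rw [hx]; simp
          refine ⟨x, Finset.mem_sdiff.2 ⟨(Finset.mem_sdiff.1 hx').1,
            fun h => (Finset.mem_sdiff.1 hx').2 (h3 h)⟩, ?_⟩
          rw [← sdiff_singleton_eq_erase, ← hx, Finset.sdiff_sdiff_eq_self h1]
        · rintro ⟨x, hx, rfl⟩
          obtain ⟨h1, h2⟩ := Finset.mem_sdiff.1 hx
          refine ⟨⟨erase_subset _ _, ?_⟩, subset_erase.2 ⟨htS, h2⟩⟩
          rw [card_erase_of_mem h1]; omega
      rw [this, card_image_of_injOn, card_sdiff_of_subset htS]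
      · omega
      · exact (erase_injOn S).mono (coe_subset.2 sdiff_subset)
    unfold starWeight
    rw [sum_congr rfl hw, sum_const, nsmul_eq_mul]
    have hr : (((kSimplices k (initComplex k)).filter (fun s => t ⊆ s)).card : ℝ)
        = k + 2 - t.card := by
      rw [eq_sub_iff_add_eq]; exact_mod_cast hcount
    have hr2 : (cofaceCount t.card (initComplex k) t : ℝ) = k + 2 - t.card := by
      rw [eq_sub_iff_add_eq]; exact_mod_cast hdeg t htS
    rw [hr, hr2]
    simp [affineWeight]
  · intro t ht _
    exact (hdeg t (hface t ht)).ge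
  · simpa using hdeg ∅ (empty_subset _)
  · intro t
    refine (card_filter_le _ _).trans ?_
    rw [hks, card_powersetCard, hSc]
    simp

end Preservation

/-- The degrees of the youngest faces of `s`. -/
def degProfile (k : ℕ) (g : Finset (Finset ℕ)) (s : Finset ℕ) : Fin (k + 1) → ℕ :=
  fun m => simDeg (m : ℕ) g (topSub s ((m : ℕ) + 1))

/-- Increase the coordinates `m` with `m < j` by one. -/
def raiseBelow (k : ℕ) (j : ℕ) (p : Fin (k + 1) → ℕ) : Fin (k + 1) → ℕ :=
  fun m => p m + if (m : ℕ) < j then 1 else 0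

/-- The weight of the star of the youngest face with `j + 1` vertices of a `k`-simplex with
degree profile `p`, and zero when `j > k`. -/
def profileWeight (k : ℕ) (δ : ℝ) (j : ℕ) (p : Fin (k + 1) → ℕ) : ℝ :=
  if h : j < k + 1 then affineWeight k δ (j + 1) (p ⟨j, h⟩) else 0

/-- The weight of the simplices raising exactly the first `j + 1` degrees of the profile
`decUpTo k j i` to give `i`. -/
def inflowCoef (k : ℕ) (δ : ℝ) (j : ℕ) (i : Fin (k + 1) → ℕ) : ℝ :=
  if raiseBelow k (j + 1) (decUpTo k j i) = i then
    profileWeight k δ j (decUpTo k j i) - profileWeight k δ (j + 1) (decUpTo k j i) else 0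

/-- The number of simplices with profile `i` which contain the vertex just arrived. -/
def newbornCount (k : ℕ) (i : Fin (k + 1) → ℕ) : ℝ :=
  if (fun m : Fin (k + 1) => k + 1 - (m : ℕ)) = i then (k : ℝ) + 1 else 0

/-- The conditional mean of `F (G (n + 1))` given `G n = g`. -/
def stepMean (k : ℕ) (δ : ℝ) (n : ℕ) (F : Finset (Finset ℕ) → ℝ) (g : Finset (Finset ℕ)) : ℝ :=
  ∑ s ∈ kSimplices k g, ((simDeg k g s : ℝ) + δ) /
    (∑ t ∈ kSimplices k g, ((simDeg k g t : ℝ) + δ)) * F (addSimplex g s (n + 1 + k + 2))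

lemma Ncount_eq_sum (k : ℕ) (g : Finset (Finset ℕ)) (i : Fin (k + 1) → ℕ) :
    (Ncount k g i : ℝ) = ∑ s ∈ kSimplices k g, if degProfile k g s = i then 1 else 0 := by
  rw [sum_boole]
  unfold Ncount degProfile
  simp only [funext_iff]

lemma eq_decUpTo_of_raiseBelow_eq {k j : ℕ} {p i : Fin (k + 1) → ℕ}
    (h : raiseBelow k (j + 1) p = i) : p = decUpTo k j i := by
  subst h
  funext m
  simp only [decUpTo, raiseBelow, Nat.lt_succ_iff]
  split_ifs <;> omega

lemma starWeight_empty (k : ℕ) (δ : ℝ) (g : Finset (Finset ℕ)) :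
    starWeight k δ g ∅ = ∑ t ∈ kSimplices k g, ((simDeg k g t : ℝ) + δ) := by
  simp [starWeight]

section Drift

variable {k : ℕ} {δ : ℝ} {n : ℕ} {g : Finset (Finset ℕ)} {s : Finset ℕ}

lemma IsPAState.topSub_mem (h : IsPAState k δ n g) (hs : s ∈ kSimplices k g) {j : ℕ}
    (hj : j < k + 1) : topSub s (j + 1) ∈ g := by
  obtain ⟨hsg, hsc⟩ := mem_kSimplices.1 hs
  refine h.down s hsg _ (topSub_subset _ _) (card_pos.1 ?_)
  rw [card_topSub (by omega)]
  omega

lemma IsPAState.degProfile_old (h : IsPAState k δ n g) (hs : s ∈ kSimplices k g)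
    {u : Finset ℕ} (hu : u ∈ kSimplices k g) (m : Fin (k + 1)) :
    degProfile k (addSimplex g s (n + 1 + k + 2)) u m
      = degProfile k g u m + if topSub u ((m : ℕ) + 1) ⊆ s then 1 else 0 := by
  have hw := h.notMem_of_fresh
  have hc : (topSub u ((m : ℕ) + 1)).card = m + 1 :=
    card_topSub (by have := (mem_kSimplices.1 hu).2; omega)
  have := cofaceCount_newFaces_of_notMem (s := s) (hw _ (h.topSub_mem hu m.2))
  rw [hc] at this
  unfold degProfile
  rw [h.addSimplex_eq hs, simDeg_eq_cofaceCount, cofaceCount_union hw, this]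
  rfl

lemma IsPAState.degProfile_new (h : IsPAState k δ n g) (hs : s ∈ kSimplices k g)
    {x : ℕ} (hx : x ∈ s) :
    degProfile k (addSimplex g s (n + 1 + k + 2)) (insert (n + 1 + k + 2) (s.erase x))
      = fun m : Fin (k + 1) => k + 1 - (m : ℕ) := by
  have hw := h.notMem_of_fresh
  obtain ⟨hsg, hsc⟩ := mem_kSimplices.1 hs
  set w := n + 1 + k + 2
  funext m
  set u := insert w (s.erase x) with hu
  have huc : u.card = k + 1 := by
    rw [card_insert_of_notMem (fun h => hw s hsg (mem_of_mem_erase h)), card_erase_of_mem hx]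
    omega
  have hc : (topSub u ((m : ℕ) + 1)).card = m + 1 := card_topSub (by omega)
  have hwt : w ∈ topSub u ((m : ℕ) + 1) :=
    mem_topSub_of_max (mem_insert_self _ _) (newSimplex_max h hs) (by omega)
  have := cofaceCount_newFaces_of_mem (hw s hsg) hwt
    ((topSub_subset _ _).trans (insert_subset_insert _ (erase_subset _ _)))
  unfold degProfile
  rw [h.addSimplex_eq hs, simDeg_eq_cofaceCount, cofaceCount_union hw, cofaceCount_eq_zero hw _ hwt]
  rw [hc] at this
  omega

lemma IsPAState.Ncount_step (h : IsPAState k δ n g) (hs : s ∈ kSimplices k g)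
    (i : Fin (k + 1) → ℕ) :
    (Ncount k (addSimplex g s (n + 1 + k + 2)) i : ℝ)
      = ∑ u ∈ kSimplices k g, (if (fun m : Fin (k + 1) => degProfile k g u m
          + if topSub u ((m : ℕ) + 1) ⊆ s then 1 else 0) = i then 1 else 0)
        + newbornCount k i := by
  rw [Ncount_eq_sum]
  conv_lhs => rw [h.addSimplex_eq hs]
  rw [sum_kSimplices_union h.notMem_of_fresh hs]
  congr 1
  · refine sum_congr rfl fun u hu => ?_
    rw [← h.addSimplex_eq hs, funext (h.degProfile_old hs hu)]
  · rw [← h.addSimplex_eq hs]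
    rw [sum_congr rfl fun x hx => by rw [h.degProfile_new hs hx], sum_const,
      (mem_kSimplices.1 hs).2]
    unfold newbornCount
    split_ifs <;> simp

lemma newbornCount_nonneg (k : ℕ) (i : Fin (k + 1) → ℕ) : 0 ≤ newbornCount k i := by
  unfold newbornCount; positivity

lemma newbornCount_le (k : ℕ) (i : Fin (k + 1) → ℕ) : newbornCount k i ≤ k + 1 := by
  unfold newbornCount
  split_ifs
  · exact le_rfl
  · positivity

/-- One step changes each degree count by a bounded amount. -/
lemma IsPAState.abs_Ncount_step_sub_le (h : IsPAState k δ n g) (hs : s ∈ kSimplices k g)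
    (i : Fin (k + 1) → ℕ) :
    |(Ncount k (addSimplex g s (n + 1 + k + 2)) i : ℝ) - Ncount k g i|
      ≤ ((k : ℝ) + 1) * (k + 3) := by
  have hB : ((kSimplices k g).filter fun u => topSub u 1 ⊆ s).card ≤ (k + 1) * (k + 2) := by
    have hsub : ((kSimplices k g).filter fun u => topSub u 1 ⊆ s)
        ⊆ s.biUnion fun v => (kSimplices k g).filter fun u => topSub u 1 = {v} := by
      intro u hu
      obtain ⟨hu, hus⟩ := mem_filter.1 hu
      obtain ⟨v, hv⟩ := card_eq_one.1
        (card_topSub (s := u) (c := 1) (by have := (mem_kSimplices.1 hu).2; omega))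
      rw [mem_biUnion]
      exact ⟨v, hus (by rw [hv]; simp), mem_filter.2 ⟨hu, hv⟩⟩
    refine (card_le_card hsub).trans ?_
    rw [← (mem_kSimplices.1 hs).2]
    exact card_biUnion_le_card_mul _ _ _ fun v _ => h.top {v}
  have hdiff : |(∑ u ∈ kSimplices k g, (if (fun m : Fin (k + 1) => degProfile k g u m
          + if topSub u ((m : ℕ) + 1) ⊆ s then 1 else 0) = i then (1 : ℝ) else 0))
      - ∑ u ∈ kSimplices k g, (if degProfile k g u = i then (1 : ℝ) else 0)|
      ≤ ((k : ℝ) + 1) * (k + 2) := by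
    rw [← sum_sub_distrib]
    refine (abs_sum_le_sum_abs _ _).trans ?_
    calc _ ≤ ∑ u ∈ kSimplices k g, if topSub u 1 ⊆ s then (1 : ℝ) else 0 := by
          refine sum_le_sum fun u _ => ?_
          by_cases hu : topSub u 1 ⊆ s
          · rw [if_pos hu]
            split_ifs <;> simp
          · have : (fun m : Fin (k + 1) => degProfile k g u m
                + if topSub u ((m : ℕ) + 1) ⊆ s then 1 else 0) = degProfile k g u := by
              funext m
              rw [if_neg fun hm => hu ((topSub_mono u (by omega)).trans hm), add_zero]
            rw [this, sub_self, abs_zero, if_neg hu]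
      _ ≤ _ := by
          rw [sum_boole]
          exact_mod_cast hB
  rw [h.Ncount_step hs, Ncount_eq_sum, add_sub_right_comm]
  have h1 := newbornCount_nonneg k i
  have h2 := newbornCount_le k i
  calc _ ≤ _ := abs_add_le _ _
    _ ≤ ((k : ℝ) + 1) * (k + 2) + (k + 1) := add_le_add hdiff (by rwa [abs_of_nonneg h1])
    _ = _ := by ring

lemma IsPAState.simDeg_pos (h : IsPAState k δ n g) (hs : s ∈ kSimplices k g) :
    1 ≤ simDeg k g s := by
  obtain ⟨hsg, hsc⟩ := mem_kSimplices.1 hs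
  have := h.deg_ge s (Or.inr hsg) hsc.le
  rw [simDeg_eq_cofaceCount, ← hsc]
  omega

lemma IsPAState.weight_pos (h : IsPAState k δ n g) (hδ : -1 < δ) (hs : s ∈ kSimplices k g) :
    0 < (simDeg k g s : ℝ) + δ := by
  have : (1 : ℝ) ≤ simDeg k g s := by exact_mod_cast h.simDeg_pos hs
  linarith

lemma IsPAState.starWeight_empty_eq (h : IsPAState k δ n g) :
    starWeight k δ g ∅ = tauc k δ * n + ((k : ℝ) + 2) * (1 + δ) := by
  rw [h.weight ∅ (Or.inl rfl) (by simp), card_empty, h.verts]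
  unfold affineWeight tauc
  push_cast
  ring

/-- The total weight of the simplices containing a youngest face depends only on the profile. -/
lemma IsPAState.sum_weight_topSub (h : IsPAState k δ n g) {u : Finset ℕ}
    (hu : u ∈ kSimplices k g) (j : ℕ) :
    ∑ s ∈ kSimplices k g, ((simDeg k g s : ℝ) + δ)
        * (if j < k + 1 ∧ topSub u (j + 1) ⊆ s then 1 else 0)
      = profileWeight k δ j (degProfile k g u) := by
  unfold profileWeight
  split_ifs with hj
  · have hc : (topSub u (j + 1)).card = j + 1 :=
      card_topSub (by have := (mem_kSimplices.1 hu).2; omega)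
    have := h.weight _ (Or.inr (h.topSub_mem hu hj)) (by omega)
    rw [hc] at this
    unfold degProfile
    rw [simDeg_eq_cofaceCount, ← this, starWeight, sum_filter]
    simp [hj]
  · simp [hj]

lemma sum_profile_cases (u : Finset ℕ) (p i : Fin (k + 1) → ℕ) :
    (if (fun m : Fin (k + 1) => p m
          + if topSub u ((m : ℕ) + 1) ⊆ s then 1 else 0) = i then (1 : ℝ) else 0)
      = ∑ j ∈ range (k + 2), (if raiseBelow k j p = i then 1 else 0)
          * ((if topSub u j ⊆ s then 1 else 0)
            - if j < k + 1 ∧ topSub u (j + 1) ⊆ s then 1 else 0) := by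
  set P : ℕ → Prop := fun j => topSub u j ⊆ s with hP
  have hmono : ∀ {a b}, a ≤ b → P b → P a := fun hab hb => (topSub_mono u hab).trans hb
  have hP0 : P 0 := by simp [hP, topSub_zero]
  set J := Nat.findGreatest P (k + 1)
  have hJ : P J := Nat.findGreatest_spec (m := 0) (Nat.zero_le _) hP0
  have hJle : J ≤ k + 1 := Nat.findGreatest_le _
  have hlt : ∀ j, J < j → j ≤ k + 1 → ¬ P j := fun j h1 h2 => Nat.findGreatest_is_greatest h1 h2
  rw [sum_eq_single J]
  · have : raiseBelow k J p = fun m : Fin (k + 1) => p m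
          + if topSub u ((m : ℕ) + 1) ⊆ s then 1 else 0 := by
      funext m
      unfold raiseBelow
      congr 1
      refine if_congr ⟨fun h => hmono h hJ, fun h => ?_⟩ rfl rfl
      by_contra hm
      exact hlt _ (by omega) (by omega) h
    rw [this, if_pos (c := topSub u J ⊆ s) hJ, if_neg (c := J < k + 1 ∧ _)]
    · simp
    · rintro ⟨h1, h2⟩
      exact hlt _ (Nat.lt_succ_self J) h1 h2
  · intro j hj hne
    have hj := mem_range.1 hj
    rcases lt_or_gt_of_ne hne with h | h
    · rw [if_pos (c := topSub u j ⊆ s) (hmono h.le hJ),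
        if_pos (c := j < k + 1 ∧ _) ⟨by omega, hmono h hJ⟩]
      simp
    · rw [if_neg (c := topSub u j ⊆ s) (hlt j h (by omega)), if_neg (c := j < k + 1 ∧ _)]
      · simp
      · rintro ⟨h1, h2⟩
        exact hlt j h (by omega) (hmono (Nat.le_succ j) h2)
  · intro hJ'
    exact absurd (mem_range.2 (by omega)) hJ'

/-- The conditional mean of a degree count is affine in degree counts. -/
lemma IsPAState.mul_stepMean_Ncount (h : IsPAState k δ n g) (i : Fin (k + 1) → ℕ)
    (hT : starWeight k δ g ∅ ≠ 0) :
    starWeight k δ g ∅ * stepMean k δ n (fun g => (Ncount k g i : ℝ)) g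
      = (starWeight k δ g ∅ - profileWeight k δ 0 i) * Ncount k g i
        + ∑ j ∈ range (k + 1), inflowCoef k δ j i * Ncount k g (decUpTo k j i)
        + starWeight k δ g ∅ * newbornCount k i := by
  set T := starWeight k δ g ∅ with hTdef
  have hTsum : T = ∑ t ∈ kSimplices k g, ((simDeg k g t : ℝ) + δ) := starWeight_empty k δ g
  have h1 : T * stepMean k δ n (fun g => (Ncount k g i : ℝ)) g
      = ∑ s ∈ kSimplices k g, ((simDeg k g s : ℝ) + δ) *
        ∑ u ∈ kSimplices k g, (if (fun m : Fin (k + 1) => degProfile k g u m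
          + if topSub u ((m : ℕ) + 1) ⊆ s then 1 else 0) = i then 1 else 0)
        + T * newbornCount k i := by
    unfold stepMean
    rw [← hTsum, mul_sum]
    conv_rhs => rw [hTsum, sum_mul]
    rw [← sum_add_distrib]
    refine sum_congr rfl fun s hs => ?_
    beta_reduce
    rw [h.Ncount_step hs]
    field_simp
  have h2 : ∀ u ∈ kSimplices k g, ∑ s ∈ kSimplices k g, ((simDeg k g s : ℝ) + δ) *
        (if (fun m : Fin (k + 1) => degProfile k g u m
          + if topSub u ((m : ℕ) + 1) ⊆ s then 1 else 0) = i then (1 : ℝ) else 0)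
      = (∑ j ∈ range (k + 1), inflowCoef k δ j i
          * if degProfile k g u = decUpTo k j i then 1 else 0)
        + (T - profileWeight k δ 0 i) * if degProfile k g u = i then 1 else 0 := by
    intro u hu
    simp_rw [sum_profile_cases u, mul_sum]
    rw [sum_comm, sum_range_succ']
    congr 1
    · refine sum_congr rfl fun j hj => ?_
      have hj := mem_range.1 hj
      have hA := h.sum_weight_topSub hu j
      have hB := h.sum_weight_topSub hu (j + 1)
      simp only [hj, true_and] at hA
      by_cases hr : raiseBelow k (j + 1) (degProfile k g u) = i
      · have hd := eq_decUpTo_of_raiseBelow_eq hr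
        unfold inflowCoef
        simp only [← hd, hr, if_true]
        rw [← hA, ← hB, mul_one, ← sum_sub_distrib]
        refine sum_congr rfl fun s _ => ?_
        ring
      · rw [sum_eq_zero fun s _ => by rw [if_neg hr, zero_mul, mul_zero]]
        by_cases hd : degProfile k g u = decUpTo k j i
        · rw [inflowCoef, ← hd, if_neg hr, zero_mul]
        · rw [if_neg hd, mul_zero]
    · have hA := h.sum_weight_topSub hu 0
      have hr0 : raiseBelow k 0 (degProfile k g u) = degProfile k g u := by
        funext m; simp [raiseBelow]
      rw [hr0]
      by_cases hi : degProfile k g u = i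
      · rw [if_pos hi, mul_one, ← hi, ← hA, hTsum, ← sum_sub_distrib]
        refine sum_congr rfl fun s _ => ?_
        rw [if_pos (c := topSub u 0 ⊆ s) (by simp [topSub_zero])]
        ring
      · simp [hi]
  rw [h1]
  congr 1
  simp_rw [mul_sum]
  rw [sum_comm, sum_congr rfl h2, sum_add_distrib, sum_comm, ← mul_sum, ← Ncount_eq_sum, add_comm]
  congr 1
  refine sum_congr rfl fun j _ => ?_
  rw [← mul_sum, Ncount_eq_sum]

/-- Either no `k`-simplex has profile `i`, or the outflow weight of `i` is a partial weight. -/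
lemma IsPAState.profileWeight_zero_mem (h : IsPAState k δ n g) (hδ : -1 < δ)
    (i : Fin (k + 1) → ℕ) (hN : Ncount k g i ≠ 0) :
    0 ≤ profileWeight k δ 0 i ∧ profileWeight k δ 0 i ≤ starWeight k δ g ∅ := by
  obtain ⟨u, hu⟩ := card_ne_zero.1 hN
  rw [mem_filter] at hu
  have hi : degProfile k g u = i := funext hu.2
  rw [← hi, ← h.sum_weight_topSub hu.1 0, starWeight_empty]
  constructor
  · refine sum_nonneg fun s hs => mul_nonneg (h.weight_pos hδ hs).le ?_
    split_ifs <;> norm_num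
  · refine sum_le_sum fun s hs => mul_le_of_le_one_right (h.weight_pos hδ hs).le ?_
    split_ifs <;> norm_num

end Drift

section Probability

variable {k : ℕ} {δ : ℝ} {Ω : Type*} [MeasurableSpace Ω] (M : PAComplex k δ Ω)

namespace PAComplex

lemma G_succ (n : ℕ) (ω : Ω) :
    M.G (n + 1) ω = addSimplex (M.G n ω) (M.choice (n + 1) ω) (n + 1 + k + 2) :=
  M.step (n + 1) ω (by omega)

lemma choice_succ_mem (n : ℕ) (ω : Ω) : M.choice (n + 1) ω ∈ kSimplices k (M.G n ω) :=
  M.choice_mem (n + 1) ω (by omega)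

lemma isPAState (n : ℕ) (ω : Ω) : IsPAState k δ n (M.G n ω) := by
  induction n with
  | zero => rw [M.init]; exact isPAState_initComplex k δ
  | succ n ih => rw [M.G_succ]; exact ih.step (M.choice_succ_mem n ω)

lemma finite_range_G (n : ℕ) : (Set.range (M.G n)).Finite := by
  induction n with
  | zero =>
    refine (Set.finite_singleton (initComplex k)).subset ?_
    rintro _ ⟨ω, rfl⟩
    exact M.init ω
  | succ n ih =>
    refine (ih.biUnion fun g _ => ((kSimplices k g).image fun s =>
      addSimplex g s (n + 1 + k + 2)).finite_toSet).subset ?_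
    rintro _ ⟨ω, rfl⟩
    rw [M.G_succ]
    exact Set.mem_biUnion ⟨ω, rfl⟩ (mem_coe.2 (mem_image_of_mem _ (M.choice_succ_mem n ω)))

lemma measurable_comp_G (n : ℕ) (F : Finset (Finset ℕ) → ℝ) :
    Measurable fun ω => F (M.G n ω) :=
  Measurable.comp measurable_from_top (M.meas_G n)

lemma integrable_comp_G (n : ℕ) (F : Finset (Finset ℕ) → ℝ) :
    Integrable (fun ω => F (M.G n ω)) M.μ := by
  have := M.isProb
  obtain ⟨C, hC⟩ := ((M.finite_range_G n).image fun g => ‖F g‖).bddAbove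
  refine Integrable.of_bound (M.measurable_comp_G n F).aestronglyMeasurable C ?_
  exact Eventually.of_forall fun ω => hC ⟨_, ⟨ω, rfl⟩, rfl⟩

lemma measurableSet_G_eq (n : ℕ) (g : Finset (Finset ℕ)) : MeasurableSet {ω | M.G n ω = g} :=
  M.meas_G n (t := {g}) trivial

lemma measurableSet_choice_eq (n : ℕ) (s : Finset ℕ) : MeasurableSet {ω | M.choice n ω = s} :=
  M.meas_choice n (t := {s}) trivial

lemma measurableSet_history_eq (n : ℕ) (g : ℕ → Finset (Finset ℕ)) :
    MeasurableSet {ω | ∀ j < n, M.G j ω = g j} := by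
  have : {ω | ∀ j < n, M.G j ω = g j} = ⋂ j ∈ Set.Iio n, {ω | M.G j ω = g j} := by
    ext; simp
  rw [this]
  exact MeasurableSet.biInter (Set.to_countable _) fun j _ => M.measurableSet_G_eq j _

/-- Decomposition of an event according to the history of the complex. -/
lemma measure_eq_tsum_history (n : ℕ) {A : Set Ω} (hA : MeasurableSet A) :
    M.μ A = ∑' h : Fin n → Finset (Finset ℕ),
      M.μ (A ∩ {ω | ∀ j < n, M.G j ω = if hj : j < n then h ⟨j, hj⟩ else ∅}) := by
  rw [← measure_iUnion]
  · congr 1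
    ext ω
    simp only [Set.mem_iUnion, Set.mem_inter_iff, Set.mem_ofPred_eq, exists_and_left]
    refine ⟨fun h => ⟨h, fun j => M.G j ω, fun j hj => by simp [hj]⟩, fun h => h.1⟩
  · intro h h' hne
    rw [Function.onFun, Set.disjoint_left]
    rintro ω ⟨-, h1⟩ ⟨-, h2⟩
    refine hne (funext fun j => ?_)
    have e1 := h1 j j.2
    have e2 := h2 j j.2
    simp only [j.2, dif_pos] at e1 e2
    exact e1.symm.trans e2
  · exact fun h => hA.inter (M.measurableSet_history_eq n _)

/-- The conditional law of the selected simplex given the current complex. -/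
lemma measure_choice_and_G (n : ℕ) (g : Finset (Finset ℕ)) {s : Finset ℕ}
    (hs : s ∈ kSimplices k g) :
    M.μ {ω | M.choice (n + 1) ω = s ∧ M.G n ω = g}
      = ENNReal.ofReal (((simDeg k g s : ℝ) + δ) /
          ∑ t ∈ kSimplices k g, ((simDeg k g t : ℝ) + δ)) * M.μ {ω | M.G n ω = g} := by
  have e0 : {ω | M.choice (n + 1) ω = s ∧ M.G n ω = g}
      = {ω | M.choice (n + 1) ω = s} ∩ {ω | M.G n ω = g} := rfl
  rw [e0, M.measure_eq_tsum_history (n + 1)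
      ((M.measurableSet_choice_eq (n + 1) s).inter (M.measurableSet_G_eq n g)),
    M.measure_eq_tsum_history (n + 1) (M.measurableSet_G_eq n g), ← ENNReal.tsum_mul_left]
  refine tsum_congr fun h => ?_
  set e : ℕ → Finset (Finset ℕ) := fun j => if hj : j < n + 1 then h ⟨j, hj⟩ else ∅ with he
  by_cases hg : e n = g
  · have hlaw := M.cond_law (n + 1) (by omega) e s (by rwa [Nat.add_sub_cancel, hg])
    rw [Nat.add_sub_cancel, hg] at hlaw
    have e1 : ({ω | M.choice (n + 1) ω = s} ∩ {ω | M.G n ω = g}) ∩ {ω | ∀ j < n + 1, M.G j ω = e j}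
        = {ω | M.choice (n + 1) ω = s ∧ ∀ j < n + 1, M.G j ω = e j} := by
      ext ω
      simp only [Set.mem_inter_iff, Set.mem_ofPred_eq]
      exact ⟨fun H => ⟨H.1.1, H.2⟩, fun H => ⟨⟨H.1, hg ▸ H.2 n (by omega)⟩, H.2⟩⟩
    have e2 : {ω | M.G n ω = g} ∩ {ω | ∀ j < n + 1, M.G j ω = e j}
        = {ω | ∀ j < n + 1, M.G j ω = e j} :=
      Set.inter_eq_right.2 fun ω H => (H n (by omega)).trans hg
    rw [e1, e2, hlaw]
  · have e2 : {ω | M.G n ω = g} ∩ {ω | ∀ j < n + 1, M.G j ω = e j} = ∅ := by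
      rw [Set.eq_empty_iff_forall_notMem]
      rintro ω ⟨H1, H2⟩
      exact hg ((H2 n (by omega)).symm.trans H1)
    rw [Set.inter_assoc, e2, Set.inter_empty]
    simp

/-- The tower property for the one-step transition. -/
lemma integral_comp_G_succ (hδ : -1 < δ) (n : ℕ) (F : Finset (Finset ℕ) → ℝ) :
    ∫ ω, F (M.G (n + 1) ω) ∂M.μ = ∫ ω, stepMean k δ n F (M.G n ω) ∂M.μ := by
  have := M.isProb
  set R := (M.finite_range_G n).toFinset with hR
  have hmem : ∀ ω, M.G n ω ∈ R := fun ω => by simp [hR]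
  have hL : ∀ ω, F (M.G (n + 1) ω) = ∑ g ∈ R, ∑ s ∈ kSimplices k g,
      {ω | M.choice (n + 1) ω = s ∧ M.G n ω = g}.indicator
        (fun _ => F (addSimplex g s (n + 1 + k + 2))) ω := by
    intro ω
    rw [sum_eq_single_of_mem _ (hmem ω), sum_eq_single_of_mem _ (M.choice_succ_mem n ω)]
    · rw [Set.indicator_of_mem (by exact ⟨rfl, rfl⟩), M.G_succ]
    · exact fun s _ hs => Set.indicator_of_notMem (fun h => hs h.1.symm) _
    · exact fun g _ hg => sum_eq_zero fun s _ =>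
        Set.indicator_of_notMem (fun h => hg h.2.symm) _
  have hRt : ∀ ω, stepMean k δ n F (M.G n ω) = ∑ g ∈ R,
      {ω | M.G n ω = g}.indicator (fun _ => stepMean k δ n F g) ω := by
    intro ω
    rw [sum_eq_single_of_mem _ (hmem ω)]
    · rw [Set.indicator_of_mem (by exact rfl)]
    · exact fun g _ hg => Set.indicator_of_notMem (fun h => hg h.symm) _
  have hmeas : ∀ s g, MeasurableSet {ω | M.choice (n + 1) ω = s ∧ M.G n ω = g} := fun s g =>
    (M.measurableSet_choice_eq (n + 1) s).inter (M.measurableSet_G_eq n g)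
  simp_rw [hL, hRt]
  rw [integral_finsetSum _ fun g _ => integrable_finsetSum _ fun s _ =>
      (integrable_const _).indicator (hmeas s g),
    integral_finsetSum _ fun g _ => (integrable_const _).indicator (M.measurableSet_G_eq n g)]
  refine sum_congr rfl fun g hg => ?_
  obtain ⟨ω, rfl⟩ : ∃ ω, M.G n ω = g := by simpa [hR] using hg
  set g := M.G n ω
  rw [integral_finsetSum _ fun s _ => (integrable_const _).indicator (hmeas s g),
    integral_indicator_const _ (M.measurableSet_G_eq n g), stepMean, smul_eq_mul, mul_sum]
  refine sum_congr rfl fun s hs => ?_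
  rw [integral_indicator_const _ (hmeas s g), Measure.real, M.measure_choice_and_G n g hs,
    ENNReal.toReal_mul, ENNReal.toReal_ofReal, smul_eq_mul, Measure.real]
  · ring
  · have hst := M.isPAState n ω
    exact div_nonneg (hst.weight_pos hδ hs).le (sum_nonneg fun t ht => (hst.weight_pos hδ ht).le)

end PAComplex

end Probability

lemma integral_add_sum_add_const {Ω ι : Type*} [MeasurableSpace Ω] {μ : Measure Ω}
    [IsProbabilityMeasure μ] {f : Ω → ℝ} {h : ι → Ω → ℝ} {S : Finset ι} (hf : Integrable f μ)
    (hh : ∀ j ∈ S, Integrable (h j) μ) (c : ℝ) :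
    ∫ ω, (f ω + ∑ j ∈ S, h j ω + c) ∂μ = ∫ ω, f ω ∂μ + ∑ j ∈ S, ∫ ω, h j ω ∂μ + c := by
  have h1 : Integrable (fun ω => ∑ j ∈ S, h j ω) μ := integrable_finsetSum S hh
  have h2 : Integrable (fun ω => f ω + ∑ j ∈ S, h j ω) μ := hf.add h1
  rw [integral_add h2 (integrable_const c), integral_add hf h1, integral_finsetSum S hh]
  simp

lemma sum_mul_sub_sq_le {ι : Type*} (S : Finset ι) (p x : ι → ℝ) (hp : ∀ s ∈ S, 0 ≤ p s)
    (hp1 : ∑ s ∈ S, p s = 1) {a c C : ℝ} (hx : ∀ s ∈ S, |x s - a| ≤ C) :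
    ∑ s ∈ S, p s * (x s - c) ^ 2 ≤ C ^ 2 + (∑ s ∈ S, p s * x s - c) ^ 2 := by
  set m := ∑ s ∈ S, p s * x s with hm
  have key : ∀ b : ℝ, ∑ s ∈ S, p s * (x s - b) ^ 2
      = ∑ s ∈ S, p s * x s ^ 2 - 2 * b * m + b ^ 2 := by
    intro b
    have : ∀ s ∈ S, p s * (x s - b) ^ 2
        = p s * x s ^ 2 - 2 * b * (p s * x s) + b ^ 2 * p s := fun s _ => by ring
    rw [sum_congr rfl this, sum_add_distrib, sum_sub_distrib, ← mul_sum, ← mul_sum, hp1, mul_one]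
  have h1 : ∑ s ∈ S, p s * (x s - a) ^ 2 ≤ C ^ 2 := by
    calc _ ≤ ∑ s ∈ S, p s * C ^ 2 := sum_le_sum fun s hs =>
          mul_le_mul_of_nonneg_left (sq_le_sq' (abs_le.1 (hx s hs)).1 (abs_le.1 (hx s hs)).2)
            (hp s hs)
      _ = C ^ 2 := by rw [← sum_mul, hp1, one_mul]
  rw [key] at h1 ⊢
  nlinarith [sq_nonneg (m - a)]

section Variance

variable {k : ℕ} {δ : ℝ}

lemma tauc_pos (k : ℕ) (hδ : -1 < δ) : 0 < tauc k δ := by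
  unfold tauc
  have : (0 : ℝ) ≤ k := Nat.cast_nonneg k
  nlinarith

lemma exists_starWeight_lower_bound (k : ℕ) (hδ : -1 < δ) : ∃ c > 0, ∀ n g,
    IsPAState k δ n g → c * ((n : ℝ) + 1) ≤ starWeight k δ g ∅ := by
  have h2 : 0 < ((k : ℝ) + 2) * (1 + δ) := mul_pos (by positivity) (by linarith)
  refine ⟨min (tauc k δ) (((k : ℝ) + 2) * (1 + δ)), lt_min (tauc_pos k hδ) h2, fun n g h => ?_⟩
  rw [h.starWeight_empty_eq]
  have h3 := mul_le_mul_of_nonneg_right (min_le_left (tauc k δ) (((k : ℝ) + 2) * (1 + δ)))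
    (Nat.cast_nonneg (α := ℝ) n)
  have h4 := min_le_right (tauc k δ) (((k : ℝ) + 2) * (1 + δ))
  linarith

lemma IsPAState.stepMean_sq_le {n : ℕ} {g : Finset (Finset ℕ)} (h : IsPAState k δ n g)
    (hδ : -1 < δ) (i : Fin (k + 1) → ℕ) (c : ℝ) (hT : starWeight k δ g ∅ ≠ 0) :
    stepMean k δ n (fun g => ((Ncount k g i : ℝ) - c) ^ 2) g
      ≤ (((k : ℝ) + 1) * (k + 3)) ^ 2
        + (stepMean k δ n (fun g => (Ncount k g i : ℝ)) g - c) ^ 2 := by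
  refine sum_mul_sub_sq_le _ _ _ (fun s hs => ?_) ?_ fun s hs => h.abs_Ncount_step_sub_le hs i
  · exact div_nonneg (h.weight_pos hδ hs).le (sum_nonneg fun t ht => (h.weight_pos hδ ht).le)
  · rw [← sum_div]
    exact div_self (by rwa [starWeight_empty] at hT)

lemma IsPAState.stepMean_Ncount {n : ℕ} {g : Finset (Finset ℕ)} (h : IsPAState k δ n g)
    (hδ : -1 < δ) (i : Fin (k + 1) → ℕ) {T a : ℝ} (hT : starWeight k δ g ∅ = T) (hT0 : 0 < T)
    (ha : a = if 0 ≤ profileWeight k δ 0 i ∧ profileWeight k δ 0 i ≤ T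
      then profileWeight k δ 0 i / T else 0) :
    stepMean k δ n (fun g => (Ncount k g i : ℝ)) g
      = (1 - a) * Ncount k g i
        + ∑ j ∈ range (k + 1), inflowCoef k δ j i / T * Ncount k g (decUpTo k j i)
        + newbornCount k i := by
  have h1 := h.mul_stepMean_Ncount i (hT ▸ hT0.ne')
  rw [hT] at h1
  have h2 : T * a * Ncount k g i = profileWeight k δ 0 i * Ncount k g i := by
    by_cases hN : Ncount k g i = 0
    · simp [hN]
    · have := h.profileWeight_zero_mem hδ i hN
      rw [hT] at this
      rw [ha, if_pos this, mul_div_cancel₀ _ hT0.ne']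
  have h3 : T * ∑ j ∈ range (k + 1), inflowCoef k δ j i / T * Ncount k g (decUpTo k j i)
      = ∑ j ∈ range (k + 1), inflowCoef k δ j i * Ncount k g (decUpTo k j i) := by
    rw [mul_sum]
    refine sum_congr rfl fun j _ => ?_
    field_simp
  refine mul_left_cancel₀ hT0.ne' ?_
  rw [h1, mul_add, mul_add, h3, mul_comm T ((1 - a) * _)]
  linarith

lemma sq_add_le_of_pos {a x y t : ℝ} (ha0 : 0 ≤ a) (ha1 : a ≤ 1) (ht : 0 < t) :
    ((1 - a) * x + y) ^ 2 ≤ (1 + 1 / (2 * t)) * x ^ 2 + (1 + 2 * t) * y ^ 2 := by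
  have h1 : ((1 - a) * x) ^ 2 ≤ x ^ 2 := by
    rw [mul_pow]
    exact mul_le_of_le_one_left (sq_nonneg x) (by nlinarith)
  have h2 : ((1 - a) * x + y) ^ 2
      ≤ (1 + 1 / (2 * t)) * ((1 - a) * x) ^ 2 + (1 + 2 * t) * y ^ 2 := by
    have : 0 ≤ ((1 - a) * x - 2 * t * y) ^ 2 / (2 * t) := by positivity
    have e : ((1 - a) * x - 2 * t * y) ^ 2 / (2 * t)
      = ((1 - a) * x) ^ 2 / (2 * t) - 2 * ((1 - a) * x) * y + 2 * t * y ^ 2 := by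
      field_simp
      ring
    rw [e] at this
    have e2 : 1 / (2 * t) * ((1 - a) * x) ^ 2 = ((1 - a) * x) ^ 2 / (2 * t) := by ring
    nlinarith
  have h3 : (0 : ℝ) ≤ 1 + 1 / (2 * t) := by positivity
  nlinarith [mul_le_mul_of_nonneg_left h1 h3]

variable {Ω : Type*} [MeasurableSpace Ω] (M : PAComplex k δ Ω)

namespace PAComplex

/-- The degree count minus its mean. -/
def centered (i : Fin (k + 1) → ℕ) (n : ℕ) (ω : Ω) : ℝ :=
  (Ncount k (M.G n ω) i : ℝ) - ∫ ω', (Ncount k (M.G n ω') i : ℝ) ∂M.μ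

lemma measurable_centered (i : Fin (k + 1) → ℕ) (n : ℕ) : Measurable (M.centered i n) :=
  M.measurable_comp_G n fun g => (Ncount k g i : ℝ) - ∫ ω', (Ncount k (M.G n ω') i : ℝ) ∂M.μ

lemma integrable_centered_sq (i : Fin (k + 1) → ℕ) (n : ℕ) :
    Integrable (fun ω => M.centered i n ω ^ 2) M.μ :=
  M.integrable_comp_G n fun g =>
    ((Ncount k g i : ℝ) - ∫ ω', (Ncount k (M.G n ω') i : ℝ) ∂M.μ) ^ 2

lemma stepMean_sub_mean (hδ : -1 < δ) (i : Fin (k + 1) → ℕ) (n : ℕ) {T a : ℝ}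
    (hT : T = tauc k δ * n + ((k : ℝ) + 2) * (1 + δ)) (hT0 : 0 < T)
    (ha : a = if 0 ≤ profileWeight k δ 0 i ∧ profileWeight k δ 0 i ≤ T
      then profileWeight k δ 0 i / T else 0) (ω : Ω) :
    stepMean k δ n (fun g => (Ncount k g i : ℝ)) (M.G n ω)
        - ∫ ω', (Ncount k (M.G (n + 1) ω') i : ℝ) ∂M.μ
      = (1 - a) * M.centered i n ω
        + ∑ j ∈ range (k + 1), inflowCoef k δ j i / T * M.centered (decUpTo k j i) n ω := by
  have := M.isProb
  have hst : ∀ ω, stepMean k δ n (fun g => (Ncount k g i : ℝ)) (M.G n ω) = _ := fun ω =>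
    (M.isPAState n ω).stepMean_Ncount hδ i ((M.isPAState n ω).starWeight_empty_eq.trans hT.symm)
      hT0 ha
  have hint : ∀ i : Fin (k + 1) → ℕ, Integrable (fun ω => (Ncount k (M.G n ω) i : ℝ)) M.μ :=
    fun i => M.integrable_comp_G n fun g => (Ncount k g i : ℝ)
  have hint' : ∀ j ∈ range (k + 1), Integrable (fun ω => inflowCoef k δ j i / T
      * (Ncount k (M.G n ω) (decUpTo k j i) : ℝ)) M.μ := fun j _ => (hint _).const_mul _
  rw [M.integral_comp_G_succ hδ n fun g => (Ncount k g i : ℝ)]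
  simp_rw [hst]
  rw [integral_add_sum_add_const ((hint i).const_mul _) hint']
  simp_rw [integral_const_mul, centered, mul_sub]
  rw [sum_sub_distrib]
  ring

/-- One-step recursion for the variance of a degree count. -/
lemma integral_centered_sq_succ_le (hδ : -1 < δ) (i : Fin (k + 1) → ℕ) {c : ℝ} (hc : 0 < c)
    (hlow : ∀ n g, IsPAState k δ n g → c * ((n : ℝ) + 1) ≤ starWeight k δ g ∅)
    (L : ℕ → ℝ) (hL : ∀ j ∈ range (k + 1), ∀ n : ℕ,
      inflowCoef k δ j i ^ 2 * ∫ ω, M.centered (decUpTo k j i) n ω ^ 2 ∂M.μ ≤ L j * (n + 1))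
    (n : ℕ) :
    ∫ ω, M.centered i (n + 1) ω ^ 2 ∂M.μ
      ≤ (1 + 1 / (2 * ((n : ℝ) + 1))) * ∫ ω, M.centered i n ω ^ 2 ∂M.μ
        + (3 * ((k : ℝ) + 1) / c ^ 2 * (∑ j ∈ range (k + 1), L j)
          + (((k : ℝ) + 1) * (k + 3)) ^ 2) := by
  have := M.isProb
  obtain ⟨ω₀⟩ : Nonempty Ω := M.μ.nonempty_of_neZero
  obtain ⟨T, hT⟩ : ∃ T, T = tauc k δ * n + ((k : ℝ) + 2) * (1 + δ) := ⟨_, rfl⟩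
  have hTω : ∀ ω, starWeight k δ (M.G n ω) ∅ = T := fun ω =>
    (M.isPAState n ω).starWeight_empty_eq.trans hT.symm
  have hn : (0 : ℝ) < (n : ℝ) + 1 := by positivity
  have hTlow : c * ((n : ℝ) + 1) ≤ T := hTω ω₀ ▸ hlow n _ (M.isPAState n ω₀)
  have hT0 : 0 < T := lt_of_lt_of_le (by positivity) hTlow
  obtain ⟨a, ha⟩ : ∃ a, a = if 0 ≤ profileWeight k δ 0 i ∧ profileWeight k δ 0 i ≤ T
      then profileWeight k δ 0 i / T else 0 := ⟨_, rfl⟩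
  have ha01 : 0 ≤ a ∧ a ≤ 1 := by
    rw [ha]
    split_ifs with h
    · exact ⟨div_nonneg h.1 hT0.le, (div_le_one hT0).2 h.2⟩
    · simp
  have hpt : ∀ ω, stepMean k δ n (fun g => ((Ncount k g i : ℝ)
        - ∫ ω', (Ncount k (M.G (n + 1) ω') i : ℝ) ∂M.μ) ^ 2) (M.G n ω)
      ≤ (1 + 1 / (2 * ((n : ℝ) + 1))) * M.centered i n ω ^ 2
        + ∑ j ∈ range (k + 1), (1 + 2 * ((n : ℝ) + 1)) * ((k : ℝ) + 1) / T ^ 2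
          * (inflowCoef k δ j i ^ 2 * M.centered (decUpTo k j i) n ω ^ 2)
        + (((k : ℝ) + 1) * (k + 3)) ^ 2 := by
    intro ω
    have h1 := (M.isPAState n ω).stepMean_sq_le hδ i
      (∫ ω', (Ncount k (M.G (n + 1) ω') i : ℝ) ∂M.μ) ((hTω ω).symm ▸ hT0.ne')
    rw [M.stepMean_sub_mean hδ i n hT hT0 ha ω] at h1
    have h2 := sq_add_le_of_pos (x := M.centered i n ω) (y := ∑ j ∈ range (k + 1),
      inflowCoef k δ j i / T * M.centered (decUpTo k j i) n ω) ha01.1 ha01.2 hn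
    have h3 : (∑ j ∈ range (k + 1), inflowCoef k δ j i / T
          * M.centered (decUpTo k j i) n ω) ^ 2
        ≤ ((k : ℝ) + 1) * ∑ j ∈ range (k + 1), (inflowCoef k δ j i / T
          * M.centered (decUpTo k j i) n ω) ^ 2 := by
      have := sq_sum_le_card_mul_sum_sq (s := range (k + 1))
        (f := fun j => inflowCoef k δ j i / T * M.centered (decUpTo k j i) n ω)
      simpa using this
    have h4 : (1 + 2 * ((n : ℝ) + 1)) * (((k : ℝ) + 1) * ∑ j ∈ range (k + 1),
          (inflowCoef k δ j i / T * M.centered (decUpTo k j i) n ω) ^ 2)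
        = ∑ j ∈ range (k + 1), (1 + 2 * ((n : ℝ) + 1)) * ((k : ℝ) + 1) / T ^ 2
          * (inflowCoef k δ j i ^ 2 * M.centered (decUpTo k j i) n ω ^ 2) := by
      rw [← mul_assoc, mul_sum]
      refine sum_congr rfl fun j _ => ?_
      field_simp
    have h5 := mul_le_mul_of_nonneg_left h3 (show (0 : ℝ) ≤ 1 + 2 * ((n : ℝ) + 1) by positivity)
    linarith
  have hint : ∀ j ∈ range (k + 1), Integrable (fun ω =>
      (1 + 2 * ((n : ℝ) + 1)) * ((k : ℝ) + 1) / T ^ 2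
          * (inflowCoef k δ j i ^ 2 * M.centered (decUpTo k j i) n ω ^ 2)) M.μ := fun j _ =>
    ((M.integrable_centered_sq _ n).const_mul _).const_mul _
  have hint1 := (M.integrable_centered_sq i n).const_mul (1 + 1 / (2 * ((n : ℝ) + 1)))
  have h6 : ∫ ω, M.centered i (n + 1) ω ^ 2 ∂M.μ
      ≤ (1 + 1 / (2 * ((n : ℝ) + 1))) * ∫ ω, M.centered i n ω ^ 2 ∂M.μ
        + ∑ j ∈ range (k + 1), (1 + 2 * ((n : ℝ) + 1)) * ((k : ℝ) + 1) / T ^ 2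
          * (inflowCoef k δ j i ^ 2 * ∫ ω, M.centered (decUpTo k j i) n ω ^ 2 ∂M.μ)
        + (((k : ℝ) + 1) * (k + 3)) ^ 2 := by
    calc _ = ∫ ω, stepMean k δ n (fun g => ((Ncount k g i : ℝ)
          - ∫ ω', (Ncount k (M.G (n + 1) ω') i : ℝ) ∂M.μ) ^ 2) (M.G n ω) ∂M.μ :=
          M.integral_comp_G_succ hδ n fun g => ((Ncount k g i : ℝ)
            - ∫ ω', (Ncount k (M.G (n + 1) ω') i : ℝ) ∂M.μ) ^ 2
      _ ≤ _ := integral_mono (M.integrable_comp_G n _)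
          ((hint1.add (integrable_finsetSum _ hint)).add (integrable_const _)) hpt
      _ = _ := by
          refine (integral_add_sum_add_const hint1 hint _).trans ?_
          simp_rw [integral_const_mul]
  refine h6.trans ?_
  rw [add_assoc]
  gcongr
  rw [mul_sum]
  refine sum_le_sum fun j hj => ?_
  have hT2 : (c * ((n : ℝ) + 1)) ^ 2 ≤ T ^ 2 := pow_le_pow_left₀ (by positivity) hTlow 2
  have hLj := hL j hj n
  have hv0 : 0 ≤ inflowCoef k δ j i ^ 2 * ∫ ω, M.centered (decUpTo k j i) n ω ^ 2 ∂M.μ :=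
    mul_nonneg (sq_nonneg _) (integral_nonneg fun _ => sq_nonneg _)
  calc _ ≤ (3 * ((n : ℝ) + 1)) * ((k : ℝ) + 1) / (c * ((n : ℝ) + 1)) ^ 2
        * (L j * (n + 1)) := by
        gcongr
        have : (0 : ℝ) ≤ n := Nat.cast_nonneg n
        linarith
    _ = _ := by field_simp

/-- The variance of every degree count grows at most linearly. -/
lemma exists_integral_centered_sq_le (hδ : -1 < δ) (i : Fin (k + 1) → ℕ) :
    ∃ K, ∀ n : ℕ, ∫ ω, M.centered i n ω ^ 2 ∂M.μ ≤ K * (n + 1) := by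
  have := M.isProb
  obtain ⟨c, hc, hlow⟩ := exists_starWeight_lower_bound k hδ
  induction hi0 : i 0 using Nat.strong_induction_on generalizing i with
  | _ i0 ih =>
    have hex : ∀ j, ∃ L, ∀ n : ℕ, inflowCoef k δ j i ^ 2
        * ∫ ω, M.centered (decUpTo k j i) n ω ^ 2 ∂M.μ ≤ L * (n + 1) := by
      intro j
      by_cases hr : raiseBelow k (j + 1) (decUpTo k j i) = i
      · have h0 := congrFun hr 0
        simp only [raiseBelow, Fin.val_zero, Nat.succ_pos, if_true] at h0
        obtain ⟨K, hK⟩ := ih (decUpTo k j i 0) (by omega) (decUpTo k j i) rfl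
        refine ⟨inflowCoef k δ j i ^ 2 * K, fun n => ?_⟩
        rw [mul_assoc]
        exact mul_le_mul_of_nonneg_left (hK n) (sq_nonneg _)
      · exact ⟨0, fun n => by simp [inflowCoef, hr]⟩
    choose L hL using hex
    have hrec := M.integral_centered_sq_succ_le hδ i hc hlow L fun j _ => hL j
    set B := 3 * ((k : ℝ) + 1) / c ^ 2 * (∑ j ∈ range (k + 1), L j)
      + (((k : ℝ) + 1) * (k + 3)) ^ 2
    refine ⟨max 0 (2 * B), fun n => ?_⟩
    induction n with
    | zero =>
      have : ∀ ω, M.centered i 0 ω = 0 := fun ω => by simp [centered, M.init]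
      simp [this]
    | succ n ihn =>
      have h1 := hrec n
      have hn : (0 : ℝ) < (n : ℝ) + 1 := by positivity
      have h2 := mul_le_mul_of_nonneg_left ihn
        (show (0 : ℝ) ≤ 1 + 1 / (2 * ((n : ℝ) + 1)) by positivity)
      have h3 : (1 + 1 / (2 * ((n : ℝ) + 1))) * (max 0 (2 * B) * ((n : ℝ) + 1))
          = max 0 (2 * B) * ((n : ℝ) + 1) + max 0 (2 * B) / 2 := by
        field_simp
      have h4 := le_max_right 0 (2 * B)
      push_cast
      linarith

lemma abs_Ncount_succ_sub_le (i : Fin (k + 1) → ℕ) (n : ℕ) (ω : Ω) :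
    |(Ncount k (M.G (n + 1) ω) i : ℝ) - Ncount k (M.G n ω) i| ≤ ((k : ℝ) + 1) * (k + 3) := by
  rw [M.G_succ]
  exact (M.isPAState n ω).abs_Ncount_step_sub_le (M.choice_succ_mem n ω) i

lemma abs_centered_succ_sub_le (i : Fin (k + 1) → ℕ) (n : ℕ) (ω : Ω) :
    |M.centered i (n + 1) ω - M.centered i n ω| ≤ 2 * (((k : ℝ) + 1) * (k + 3)) := by
  have := M.isProb
  have h1 := M.abs_Ncount_succ_sub_le i n ω
  have h2 : |∫ ω', ((Ncount k (M.G (n + 1) ω') i : ℝ) - Ncount k (M.G n ω') i) ∂M.μ|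
      ≤ ((k : ℝ) + 1) * (k + 3) := by
    have := norm_integral_le_of_norm_le_const (μ := M.μ)
      (Eventually.of_forall fun ω' =>
        (Real.norm_eq_abs _).trans_le (M.abs_Ncount_succ_sub_le i n ω'))
    simpa using this
  rw [integral_sub (M.integrable_comp_G (n + 1) fun g => (Ncount k g i : ℝ))
    (M.integrable_comp_G n fun g => (Ncount k g i : ℝ))] at h2
  unfold centered
  rw [abs_le] at *
  constructor <;> linarith [h1.1, h1.2, h2.1, h2.2]

end PAComplex

end Variance

/-- A strong law of large numbers: if the second moments grow at most linearly and the increments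
are bounded, then the sequence is almost surely sublinear. -/
lemma ae_tendsto_div_of_integral_sq_le {Ω : Type*} [MeasurableSpace Ω] {μ : Measure Ω}
    {Z : ℕ → Ω → ℝ} (hmeas : ∀ n, Measurable (Z n))
    (hint : ∀ n, Integrable (fun ω => Z n ω ^ 2) μ) {K C : ℝ}
    (hK : ∀ n : ℕ, ∫ ω, Z n ω ^ 2 ∂μ ≤ K * (n + 1))
    (hC : ∀ n ω, |Z (n + 1) ω - Z n ω| ≤ C) :
    ∀ᵐ ω ∂μ, Tendsto (fun n : ℕ => Z n ω / n) atTop (nhds 0) := by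
  have hK0 : 0 ≤ K := by
    have := hK 0
    simp only [Nat.cast_zero, zero_add, mul_one] at this
    exact (integral_nonneg fun _ => sq_nonneg _).trans this
  have hsum : ∑' m : ℕ, ∫⁻ ω, ENNReal.ofReal ((Z ((m + 1) ^ 2) ω / ((m : ℝ) + 1) ^ 2) ^ 2) ∂μ
      ≠ ⊤ := by
    have hle : ∀ m : ℕ, ∫⁻ ω, ENNReal.ofReal ((Z ((m + 1) ^ 2) ω / ((m : ℝ) + 1) ^ 2) ^ 2) ∂μ
        ≤ ENNReal.ofReal (2 * K * (1 / ((m : ℝ) + 1) ^ 2)) := by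
      intro m
      simp_rw [div_pow]
      rw [← ofReal_integral_eq_lintegral_ofReal ((hint _).div_const _)
        (Eventually.of_forall fun ω => by positivity), integral_div]
      refine ENNReal.ofReal_le_ofReal ?_
      have h1 := hK ((m + 1) ^ 2)
      push_cast at h1
      rw [div_le_iff₀ (by positivity)]
      refine h1.trans ?_
      have : 2 * K * (1 / ((m : ℝ) + 1) ^ 2) * (((m : ℝ) + 1) ^ 2) ^ 2
          = K * (2 * ((m : ℝ) + 1) ^ 2) := by
        field_simp
      rw [this]
      refine mul_le_mul_of_nonneg_left ?_ hK0
      have : (0 : ℝ) ≤ m := Nat.cast_nonneg m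
      nlinarith
    have hs : Summable fun m : ℕ => 2 * K * (1 / ((m : ℝ) + 1) ^ 2) := by
      refine Summable.mul_left _ ?_
      have := (summable_nat_add_iff 1).2 (Real.summable_one_div_nat_pow.2 (one_lt_two))
      simpa using this
    refine ne_top_of_le_ne_top ?_ (ENNReal.tsum_le_tsum hle)
    rw [← ENNReal.ofReal_tsum_of_nonneg (fun m => by positivity) hs]
    exact ENNReal.ofReal_ne_top
  have hm : ∀ m : ℕ, Measurable fun ω =>
      ENNReal.ofReal ((Z ((m + 1) ^ 2) ω / ((m : ℝ) + 1) ^ 2) ^ 2) := fun m =>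
    (((hmeas _).div_const _).pow_const 2).ennreal_ofReal
  rw [← lintegral_tsum fun m => (hm m).aemeasurable] at hsum
  have hae := ae_lt_top (Measurable.tsum hm) hsum
  filter_upwards [hae] with ω hω
  have h1 := ENNReal.tendsto_atTop_zero_of_tsum_ne_top hω.ne
  have h2 : Tendsto (fun m : ℕ => (Z ((m + 1) ^ 2) ω / ((m : ℝ) + 1) ^ 2) ^ 2)
      atTop (nhds 0) := by
    have := (ENNReal.tendsto_toReal ENNReal.zero_ne_top).comp h1
    simpa [Function.comp_def, ENNReal.toReal_ofReal, sq_nonneg] using this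
  have h3 : Tendsto (fun m : ℕ => |Z (m ^ 2) ω| / (m : ℝ) ^ 2) atTop (nhds 0) := by
    rw [← tendsto_add_atTop_iff_nat 1]
    have := h2.sqrt
    simp only [Real.sqrt_sq_eq_abs, Real.sqrt_zero, abs_div] at this
    refine this.congr fun m => ?_
    push_cast
    rw [abs_of_nonneg (show (0 : ℝ) ≤ ((m : ℝ) + 1) ^ 2 by positivity)]
  have hC0 : 0 ≤ C := (abs_nonneg _).trans (hC 0 ω)
  have hincr : ∀ a b : ℕ, |Z (a + b) ω| ≤ |Z a ω| + C * b := by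
    intro a b
    induction b with
    | zero => simp
    | succ b ih =>
      have h4 := abs_sub_abs_le_abs_sub (Z (a + b + 1) ω) (Z (a + b) ω)
      have h5 := hC (a + b) ω
      rw [← add_assoc]
      push_cast
      linarith
  have hsqrt : Tendsto Nat.sqrt atTop atTop := by
    refine tendsto_atTop.2 fun b => ?_
    filter_upwards [eventually_ge_atTop (b * b)] with n hn
    exact Nat.le_sqrt.2 hn
  have h6 : Tendsto (fun m : ℕ => |Z (m ^ 2) ω| / (m : ℝ) ^ 2 + 2 * C / m) atTop (nhds 0) := by
    simpa using h3.add (tendsto_const_div_atTop_nhds_zero_nat (2 * C))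
  refine squeeze_zero_norm' ?_ (h6.comp hsqrt)
  filter_upwards [eventually_ge_atTop 1] with n hn
  set m := Nat.sqrt n with hmdef
  have hm1 : 1 ≤ m := Nat.le_sqrt.2 (by simpa using hn)
  have hmn : m ^ 2 ≤ n := Nat.sqrt_le' n
  have hnm : n ≤ m ^ 2 + 2 * m := by
    have := Nat.sqrt_le_add n
    rw [← hmdef] at this
    nlinarith
  have h7 := hincr (m ^ 2) (n - m ^ 2)
  rw [Nat.add_sub_cancel' hmn] at h7
  have h8 : ((n - m ^ 2 : ℕ) : ℝ) ≤ 2 * m := by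
    have : n - m ^ 2 ≤ 2 * m := by omega
    exact_mod_cast this
  have hm0 : (0 : ℝ) < m := by exact_mod_cast hm1
  have hmn' : (m : ℝ) ^ 2 ≤ n := by exact_mod_cast hmn
  rw [Real.norm_eq_abs, abs_div, Nat.abs_cast, Function.comp_apply]
  calc |Z n ω| / n ≤ (|Z (m ^ 2) ω| + C * (2 * m)) / n := by
        gcongr
        exact h7.trans (by gcongr)
    _ ≤ (|Z (m ^ 2) ω| + C * (2 * m)) / (m : ℝ) ^ 2 := by
        gcongr
    _ = |Z (m ^ 2) ω| / (m : ℝ) ^ 2 + 2 * C / m := by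
        field_simp

/-- For every fixed valid index vector, `N_n(i_0,…,i_k)/n - E[N_n(i_0,…,i_k)]/n → 0`
almost surely. -/
theorem degree_counts_concentration (k : ℕ) (δ : ℝ) (hδ : -1 < δ)
    (Ω : Type*) [MeasurableSpace Ω] (M : PAComplex k δ Ω)
    (i : Fin (k + 1) → ℕ) (hi : ValidIdx k i) :
    ∀ᵐ ω ∂M.μ, Tendsto
      (fun n : ℕ => (Ncount k (M.G n ω) i : ℝ) / n
        - (∫ ω', (Ncount k (M.G n ω') i : ℝ) ∂M.μ) / n)
      atTop (nhds 0) := by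
  obtain ⟨K, hK⟩ := M.exists_integral_centered_sq_le hδ i
  filter_upwards [ae_tendsto_div_of_integral_sq_le (M.measurable_centered i)
    (M.integrable_centered_sq i) hK (M.abs_centered_succ_sub_le i)] with ω hω
  simpa only [PAComplex.centered, sub_div] using hω
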